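/- arXiv:2512.01173 — 5 statements merged into one kernel-verified Lean document; each statement's English description precedes it below -/
import Mathlib

section
/- Let T : A(𝕋)₊ → A(𝕋)₊ be a surjective map satisfying (T f + T g)(𝕋) = (f + g)(𝕋) for all f, g ∈ A(𝕋)₊ (i.e., σ(Tf + Tg) = σ(f + g)). Then either T f = f for all f ∈ A(𝕋)₊, or T f = f̄ for all f ∈ A(𝕋)₊, where f̄ denotes the pointwise complex conjugate of f (equivalently, (T f)(e^{it}) = f(e^{−it}) for all t). -/
/-- The `n`-th Fourier coefficient of a function on the unit circle:
`f̂(n) = (1/2π) ∫₀^{2π} f(e^{iθ}) e^{-inθ} dθ`. -/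
noncomputable def fourierCoeffCircle (f : Circle → ℂ) (n : ℤ) : ℂ :=
  (1 / (2 * Real.pi)) * ∫ θ in (0:ℝ)..(2 * Real.pi),
    f (Circle.exp θ) * Complex.exp (-(n : ℂ) * Complex.I * θ)

/-- Membership in the Wiener algebra `A(𝕋)`: continuous functions on the circle
whose Fourier coefficients are absolutely summable. -/
def InWiener (f : Circle → ℂ) : Prop :=
  Continuous f ∧ Summable fun n : ℤ => ‖fourierCoeffCircle f n‖

/-- Membership in the positive cone `A(𝕋)₊`: members of the Wiener algebra all of
whose Fourier coefficients are nonnegative real numbers. -/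
def InWienerPlus (f : Circle → ℂ) : Prop :=
  InWiener f ∧ ∀ n : ℤ, ∃ r : ℝ, 0 ≤ r ∧ fourierCoeffCircle f n = (r : ℂ)

open Filter Topology

theorem fourierCoeffCircle_eq_fourierCoeff [Fact (0 < 2 * Real.pi)] (f : Circle → ℂ) (n : ℤ) :
    fourierCoeffCircle f n =
      fourierCoeff (T := 2 * Real.pi) (fun x => f (AddCircle.toCircle x)) n := by
  rw [fourierCoeff_eq_intervalIntegral _ n 0, fourierCoeffCircle]
  have hpi : (2 * Real.pi) ≠ 0 := Real.two_pi_pos.ne'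
  simp only [zero_add, Complex.real_smul]
  push_cast
  congr 1
  refine intervalIntegral.integral_congr fun θ _ => ?_
  have hpi' : (2 * (Real.pi : ℂ)) ≠ 0 := by exact_mod_cast hpi
  simp only [fourier_coe_apply, AddCircle.toCircle_apply_mk, smul_eq_mul]
  rw [div_self hpi, one_mul, mul_comm]
  congr 2
  push_cast
  field_simp

theorem fourierCoeffCircle_const_mul_zpow (b : ℂ) (k n : ℤ) :
    fourierCoeffCircle (fun z => b * (z : ℂ) ^ k) n = if n = k then b else 0 := by
  have : Fact (0 < 2 * Real.pi) := ⟨Real.two_pi_pos⟩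
  rw [fourierCoeffCircle_eq_fourierCoeff]
  have h : (fun x : AddCircle (2 * Real.pi) => b * ((AddCircle.toCircle x : Circle) : ℂ) ^ k) =
      fun x => b * fourier k x := by
    funext x
    rw [fourier_apply, AddCircle.toCircle_zsmul, Circle.coe_zpow]
  rw [h, fourierCoeff.const_mul, fourierCoeff_fourier, Pi.single_apply]
  split_ifs <;> simp

theorem Circle.norm_zpow_coe (z : Circle) (n : ℤ) : ‖(z : ℂ) ^ n‖ = 1 := by
  rw [norm_zpow, Circle.norm_coe, one_zpow]

theorem Circle.continuous_zpow_coe (n : ℤ) : Continuous fun z : Circle => (z : ℂ) ^ n :=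
  Continuous.comp (g := ((↑) : Circle → ℂ)) continuous_subtype_val
    (continuous_zpow (G := Circle) n)

theorem fourierCoeffCircle_of_hasSum {b : ℤ → ℂ} {f : Circle → ℂ} (hb : Summable fun n => ‖b n‖)
    (hf : ∀ z : Circle, HasSum (fun n => b n * (z : ℂ) ^ n) (f z)) (n : ℤ) :
    fourierCoeffCircle f n = b n := by
  have hI : HasSum (fun k => ∫ θ in (0:ℝ)..(2 * Real.pi),
      (b k * (Circle.exp θ : ℂ) ^ k) * Complex.exp (-(n : ℂ) * Complex.I * θ))
      (∫ θ in (0:ℝ)..(2 * Real.pi),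
        f (Circle.exp θ) * Complex.exp (-(n : ℂ) * Complex.I * θ)) := by
    refine intervalIntegral.hasSum_integral_of_dominated_convergence (fun k _ => ‖b k‖)
      (fun k => ?_) (fun k => ?_) ?_ ?_ ?_
    · refine Continuous.aestronglyMeasurable ?_
      have := (Circle.continuous_zpow_coe k).comp Circle.exp.continuous
      simp only [Function.comp_def] at this
      fun_prop
    · refine Eventually.of_forall fun θ _ => le_of_eq ?_
      have : -(n : ℂ) * Complex.I * θ = ((-n * θ : ℝ) : ℂ) * Complex.I := by push_cast; ring
      rw [norm_mul, norm_mul, Circle.norm_zpow_coe, this, Complex.norm_exp_ofReal_mul_I]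
      ring
    · exact Eventually.of_forall fun θ _ => hb
    · exact intervalIntegrable_const
    · exact Eventually.of_forall fun θ _ => (hf _).mul_right _
  have h := hI.mul_left (1 / (2 * (Real.pi : ℂ)))
  have h2 : HasSum (fun k => fourierCoeffCircle (fun z => b k * (z : ℂ) ^ k) n)
      (fourierCoeffCircle f n) := h
  simp only [fourierCoeffCircle_const_mul_zpow] at h2
  refine h2.unique ?_
  convert hasSum_ite_eq n (b n) using 2 with k
  grind

theorem inWienerPlus_iff {f : Circle → ℂ} :
    InWienerPlus f ↔ ∃ a : ℤ → ℝ, (∀ n, 0 ≤ a n) ∧ Summable a ∧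
      ∀ z : Circle, HasSum (fun n => (a n : ℂ) * (z : ℂ) ^ n) (f z) := by
  constructor
  · rintro ⟨⟨hc, hs⟩, hpos⟩
    choose a ha0 ha using hpos
    have hsa : Summable a := by
      refine hs.congr fun n => ?_
      rw [ha, Complex.norm_real, Real.norm_of_nonneg (ha0 n)]
    refine ⟨a, ha0, hsa, fun z => ?_⟩
    have : Fact (0 < 2 * Real.pi) := ⟨Real.two_pi_pos⟩
    let F : C(AddCircle (2 * Real.pi), ℂ) :=
      ⟨fun x => f (AddCircle.toCircle x), hc.comp AddCircle.continuous_toCircle⟩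
    have hF : fourierCoeff F = fun n => (a n : ℂ) := by
      funext n
      rw [← ha, fourierCoeffCircle_eq_fourierCoeff]
      rfl
    have hsum : Summable (fourierCoeff F) := by
      rw [hF]
      exact Complex.hasSum_ofReal.2 hsa.hasSum |>.summable
    obtain ⟨x, rfl⟩ := (AddCircle.homeomorphCircle Real.two_pi_pos.ne').surjective z
    have := has_pointwise_sum_fourier_series_of_summable hsum x
    rw [hF] at this
    simpa [fourier_apply, AddCircle.toCircle_zsmul, F, AddCircle.homeomorphCircle_apply] using this
  · rintro ⟨a, ha0, hsa, hf⟩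
    have hn : Summable fun n => ‖(a n : ℂ)‖ := by
      refine hsa.congr fun n => ?_
      rw [Complex.norm_real, Real.norm_of_nonneg (ha0 n)]
    have hcoe := fourierCoeffCircle_of_hasSum hn hf
    refine ⟨⟨?_, ?_⟩, fun n => ⟨a n, ha0 n, hcoe n⟩⟩
    · have : f = fun z : Circle => ∑' n, (a n : ℂ) * (z : ℂ) ^ n :=
        funext fun z => (hf z).tsum_eq.symm
      rw [this]
      refine continuous_tsum (fun n => ?_) hn fun n z => ?_
      · exact continuous_const.mul (Circle.continuous_zpow_coe n)
      · rw [norm_mul, Circle.norm_zpow_coe, mul_one]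
    · simpa only [hcoe] using hn

theorem inWienerPlus_const_mul_zpow {c : ℝ} (hc : 0 ≤ c) (k : ℤ) :
    InWienerPlus fun z => (c : ℂ) * (z : ℂ) ^ k := by
  refine inWienerPlus_iff.2 ⟨fun n => if n = k then c else 0, fun n => ?_, ?_, fun z => ?_⟩
  · dsimp only
    split_ifs <;> simp [hc]
  · exact (hasSum_ite_eq k c).summable
  · convert hasSum_ite_eq k ((c : ℂ) * (z : ℂ) ^ k) using 2 with n
    split_ifs with h <;> simp [h]

theorem inWienerPlus_conj {f : Circle → ℂ} (hf : InWienerPlus f) :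
    (InWienerPlus fun z => (starRingEnd ℂ) (f z)) ∧
      ∀ z, f z⁻¹ = (starRingEnd ℂ) (f z) := by
  obtain ⟨a, ha0, hsa, h⟩ := inWienerPlus_iff.1 hf
  have key : ∀ z : Circle, HasSum (fun n => (a n : ℂ) * ((z⁻¹ : Circle) : ℂ) ^ n)
      ((starRingEnd ℂ) (f z)) := fun z => by
    simpa only [map_mul, Complex.conj_ofReal, map_zpow₀, Circle.coe_inv_eq_conj] using
      Complex.hasSum_conj'.2 (h z)
  refine ⟨inWienerPlus_iff.2 ⟨fun n => a (-n), fun n => ha0 _,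
    (Equiv.neg ℤ).summable_iff.2 hsa, fun z => ?_⟩, fun z => (h z⁻¹).unique (key z)⟩
  convert (Equiv.neg ℤ).hasSum_iff.2 (key z) using 2 with n
  simp

theorem Circle.exists_zpow_eq_neg_zpow {n m : ℤ} (h : n ≠ m) :
    ∃ z : Circle, (z : ℂ) ^ n = -(z : ℂ) ^ m := by
  have hd : ((n - m : ℤ) : ℝ) ≠ 0 := by exact_mod_cast sub_ne_zero.2 h
  refine ⟨Circle.exp (Real.pi / ((n - m : ℤ) : ℝ)), ?_⟩
  have key : Circle.exp (Real.pi / ((n - m : ℤ) : ℝ)) ^ (n - m) = Circle.exp Real.pi := by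
    rw [← Circle.exp_intCast_mul, mul_div_cancel₀ _ hd]
  have key' := congrArg (Subtype.val : Circle → ℂ) key
  rw [Circle.coe_zpow, zpow_sub₀ (Circle.coe_ne_zero _),
    div_eq_iff (zpow_ne_zero _ (Circle.coe_ne_zero _))] at key'
  rw [key', Circle.coe_exp, Complex.exp_pi_mul_I, neg_one_mul]

theorem eq_of_add_le_norm_add_zpow {a b : ℝ} (ha : 0 < a) (hb : 0 < b) {n m : ℤ}
    (h : ∀ z : Circle, a + b ≤ ‖(a : ℂ) * (z : ℂ) ^ n + (b : ℂ) * (z : ℂ) ^ m‖) : n = m := by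
  by_contra hnm
  obtain ⟨z, hz⟩ := Circle.exists_zpow_eq_neg_zpow hnm
  have h1 := h z
  have h2 : (a : ℂ) * (z : ℂ) ^ n + (b : ℂ) * (z : ℂ) ^ m = ((b - a : ℝ) : ℂ) * (z : ℂ) ^ m := by
    rw [hz]; push_cast; ring
  rw [h2, norm_mul, Circle.norm_zpow_coe, mul_one, Complex.norm_real, Real.norm_eq_abs] at h1
  cases abs_cases (b - a) <;> linarith

theorem InWienerPlus.eq_const_mul_zpow {f : Circle → ℂ} (hf : InWienerPlus f) {c : ℝ} (hc : 0 < c)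
    (h : ∀ z, ‖f z‖ = c) : ∃ k : ℤ, f = fun z : Circle => (c : ℂ) * (z : ℂ) ^ k := by
  obtain ⟨a, ha0, hsa, hs⟩ := inWienerPlus_iff.1 hf
  have hsum : HasSum a c := by
    have h1 : HasSum (fun n => (a n : ℂ)) (f 1) := by simpa using hs 1
    have h2 : f 1 = ((∑' n, a n : ℝ) : ℂ) := h1.unique (Complex.hasSum_ofReal.2 hsa.hasSum)
    have h3 := h 1
    rw [h2, Complex.norm_real, Real.norm_of_nonneg (tsum_nonneg ha0)] at h3
    exact h3 ▸ hsa.hasSum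
  have huniq : ∀ n m, 0 < a n → 0 < a m → n = m := by
    intro n m hn hm
    by_contra hnm
    refine hnm (eq_of_add_le_norm_add_zpow hn hm fun z => ?_)
    have h1 := ((hs z).sub (hasSum_ite_eq n ((a n : ℂ) * (z : ℂ) ^ n))).sub
      (hasSum_ite_eq m ((a m : ℂ) * (z : ℂ) ^ m))
    have h2 := (hsum.sub (hasSum_ite_eq n (a n))).sub (hasSum_ite_eq m (a m))
    have h3 := h1.norm_le_of_bounded h2 fun k => by
      by_cases hkn : k = n
      · subst hkn
        simp [hnm]
      · by_cases hkm : k = m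
        · subst hkm
          simp [hkn]
        · simp [hkn, hkm, abs_of_nonneg (ha0 k), Circle.norm_coe]
    have h4 := norm_sub_norm_le (f z) ((a n : ℂ) * (z : ℂ) ^ n + (a m : ℂ) * (z : ℂ) ^ m)
    rw [← sub_sub, h z] at h4
    linarith
  have hex : ∃ k, 0 < a k := by
    by_contra! hno
    have : a = fun _ => 0 := funext fun k => le_antisymm (hno k) (ha0 k)
    rw [this] at hsum
    exact hc.ne (hasSum_zero.unique hsum)
  obtain ⟨k, hk⟩ := hex
  have hzero : ∀ n, n ≠ k → a n = 0 := fun n hn =>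
    le_antisymm (not_lt.1 fun hpos => hn (huniq n k hpos hk)) (ha0 n)
  have hck : a k = c := (hasSum_single k hzero).unique hsum
  refine ⟨k, funext fun z => (hs z).unique ?_⟩
  rw [← hck]
  exact hasSum_single k fun n hn => by simp [hzero n hn]

theorem re_le_of_forall_exists_add_mul_eq {f g : Circle → ℂ} (hg : Continuous g)
    {p : Circle → Circle}
    (h : ∀ n : ℕ, 0 < n → ∀ ζ, ∃ z : Circle, f ζ + n * (p ζ : ℂ) = g z + n * (z : ℂ))
    (ζ : Circle) : ((p ζ : ℂ)⁻¹ * f ζ).re ≤ ((p ζ : ℂ)⁻¹ * g (p ζ)).re := by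
  choose z hz using fun n : ℕ => h (n + 1) n.succ_pos ζ
  set w := p ζ
  obtain ⟨M, hM⟩ := isCompact_univ.exists_bound_of_continuousOn hg.continuousOn
  have hlim : Tendsto z atTop (𝓝 w) := by
    rw [tendsto_iff_dist_tendsto_zero]
    refine squeeze_zero (fun _ => dist_nonneg) (fun n => ?_)
      (tendsto_const_div_atTop_nhds_zero_nat (M + ‖f ζ‖) |>.comp (tendsto_add_atTop_nat 1))
    have hpos : (0 : ℝ) < ((n + 1 : ℕ) : ℝ) := by positivity
    rw [Function.comp_apply, le_div_iff₀ hpos]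
    change dist (z n : ℂ) w * _ ≤ _
    rw [dist_comm, dist_eq_norm]
    have h1 : ((w : ℂ) - z n) * ((n + 1 : ℕ) : ℂ) = g (z n) - f ζ := by linear_combination hz n
    have h2 := congrArg norm h1
    rw [norm_mul, Complex.norm_natCast] at h2
    rw [h2]
    exact (norm_sub_le _ _).trans (by gcongr; exact hM _ trivial)
  have hcont : Continuous fun y : Circle => ((w : ℂ)⁻¹ * g y).re := by fun_prop
  refine ge_of_tendsto' ((hcont.tendsto w).comp hlim) fun n => ?_
  have hw : (w : ℂ)⁻¹ * w = 1 := inv_mul_cancel₀ (Circle.coe_ne_zero w)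
  have h1 : (w : ℂ)⁻¹ * f ζ + ((n + 1 : ℕ) : ℝ) =
      (w : ℂ)⁻¹ * g (z n) + ((n + 1 : ℕ) : ℝ) * ((w : ℂ)⁻¹ * z n) := by
    push_cast
    have := hz n
    push_cast at this
    linear_combination (w : ℂ)⁻¹ * this - ((n : ℂ) + 1) * hw
  have h2 := congrArg Complex.re h1
  rw [Complex.add_re, Complex.add_re, Complex.ofReal_re, Complex.re_ofReal_mul] at h2
  have h3 : ((w : ℂ)⁻¹ * z n).re ≤ 1 := (Complex.re_le_norm _).trans (by simp [Circle.norm_coe])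
  have h4 : (0 : ℝ) < ((n + 1 : ℕ) : ℝ) := by positivity
  simp only [Function.comp_apply]
  nlinarith

theorem coeff_add_coeff_eq_zero {d : ℤ → ℝ} (hd : Summable d) {D : Circle → ℂ}
    (hD : ∀ z : Circle, HasSum (fun n => (d n : ℂ) * (z : ℂ) ^ n) (D z)) {s : ℤ}
    (hre : ∀ z : Circle, ((z : ℂ) ^ s * D z).re = 0) (n : ℤ) : d (n - s) + d (-n - s) = 0 := by
  have h1 : ∀ z : Circle, HasSum (fun n => (d (n - s) : ℂ) * (z : ℂ) ^ n) ((z : ℂ) ^ s * D z) := by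
    intro z
    refine ((Equiv.subRight s).hasSum_iff.2 ((hD z).mul_left ((z : ℂ) ^ s))).congr_fun fun k => ?_
    simp only [Function.comp_apply, Equiv.subRight_apply]
    rw [mul_left_comm, ← zpow_add₀ (Circle.coe_ne_zero z), add_sub_cancel]
  have h2 : ∀ z : Circle, HasSum (fun n => (d (-n - s) : ℂ) * (z : ℂ) ^ n)
      ((starRingEnd ℂ) ((z : ℂ) ^ s * D z)) := by
    intro z
    convert (Equiv.neg ℤ).hasSum_iff.2 (Complex.hasSum_conj'.2 (h1 z)) using 1
    funext k
    simp [← Circle.coe_inv_eq_conj]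
  have h3 : ∀ z : Circle, HasSum (fun n => ((d (n - s) + d (-n - s) : ℝ) : ℂ) * (z : ℂ) ^ n) 0 := by
    intro z
    convert (h1 z).add (h2 z) using 1
    · funext k
      push_cast
      ring
    · rw [Complex.add_conj, hre]
      simp
  have hsum : Summable fun n => ‖((d (n - s) + d (-n - s) : ℝ) : ℂ)‖ := by
    simp only [Complex.norm_real]
    have h4 : Summable fun n => d (n - s) := (Equiv.subRight s).summable_iff.2 hd
    have h5 : Summable fun n => d (-n - s) := (Equiv.neg ℤ).summable_iff.2 h4
    exact (h4.add h5).norm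
  have h6 := fourierCoeffCircle_of_hasSum (f := fun _ => 0) hsum h3 n
  have h7 : fourierCoeffCircle (fun _ => 0) n = 0 := by simp [fourierCoeffCircle]
  exact_mod_cast h6.symm.trans h7

theorem eq_zero_of_summable_of_periodic {d : ℤ → ℝ} (hd : Summable d) {q : ℤ} (hq : q ≠ 0)
    (hper : ∀ n, d (n + q) = d n) : d = 0 := by
  funext n
  have hconst : ∀ k : ℕ, d (n + k * q) = d n := by
    intro k
    induction k with
    | zero => simp
    | succ k ih =>
      rw [← ih, ← hper (n + k * q)]
      congr 1
      push_cast
      ring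
  have hinj : Function.Injective fun k : ℕ => n + k * q := fun k l hkl => by
    simpa [hq] using hkl
  have hlim := hd.tendsto_cofinite_zero.comp
    (Nat.cofinite_eq_atTop ▸ hinj.tendsto_cofinite : Tendsto (fun k : ℕ => n + k * q) atTop cofinite)
  simp only [Function.comp_def, hconst] at hlim
  exact tendsto_nhds_unique tendsto_const_nhds hlim

theorem InWienerPlus.eq_of_range_add_eq {f g : Circle → ℂ} (hf : InWienerPlus f)
    (hg : InWienerPlus g)
    (h1 : ∀ c : ℝ, 0 < c → (Set.range fun z : Circle => f z + c * (z : ℂ)) =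
      Set.range fun z : Circle => g z + c * (z : ℂ))
    (h2 : ∀ c : ℝ, 0 < c → (Set.range fun z : Circle => f z + c * (z : ℂ)⁻¹) =
      Set.range fun z : Circle => g z + c * (z : ℂ)⁻¹) : f = g := by
  have half : ∀ {f g : Circle → ℂ}, Continuous g →
      (∀ c : ℝ, 0 < c → (Set.range fun z : Circle => f z + c * (z : ℂ)) =
        Set.range fun z : Circle => g z + c * (z : ℂ)) →
      ∀ w : Circle, ((w : ℂ)⁻¹ * f w).re ≤ ((w : ℂ)⁻¹ * g w).re := by
    intro f g hg h w
    refine re_le_of_forall_exists_add_mul_eq (p := id) hg (fun n hn ζ => ?_) w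
    have hmem : f ζ + ((n : ℝ) : ℂ) * (ζ : ℂ) ∈
        Set.range fun z : Circle => g z + ((n : ℝ) : ℂ) * (z : ℂ) :=
      h n (by exact_mod_cast hn) ▸ Set.mem_range_self ζ
    obtain ⟨z, hz⟩ := hmem
    exact ⟨z, by simpa using hz.symm⟩
  have halfinv : ∀ {f g : Circle → ℂ}, Continuous g →
      (∀ c : ℝ, 0 < c → (Set.range fun z : Circle => f z + c * (z : ℂ)⁻¹) =
        Set.range fun z : Circle => g z + c * (z : ℂ)⁻¹) →
      ∀ w : Circle, ((w : ℂ) * f w).re ≤ ((w : ℂ) * g w).re := by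
    intro f g hg h w
    have := half (f := fun z => f z⁻¹) (g := fun z => g z⁻¹) (hg.comp continuous_inv)
      (fun c hc => ?_) w⁻¹
    · simpa using this
    · have e := h c hc
      rw [← (Equiv.inv Circle).surjective.range_comp,
        ← (Equiv.inv Circle).surjective.range_comp (fun z : Circle => g z + c * (z : ℂ)⁻¹)] at e
      simpa [Function.comp_def] using e
  obtain ⟨a, -, hsa, hfa⟩ := inWienerPlus_iff.1 hf
  obtain ⟨b, -, hsb, hgb⟩ := inWienerPlus_iff.1 hg
  have hd : Summable fun n => a n - b n := hsa.sub hsb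
  have hD : ∀ z : Circle, HasSum (fun n => ((a n - b n : ℝ) : ℂ) * (z : ℂ) ^ n) (f z - g z) := by
    intro z
    refine ((hfa z).sub (hgb z)).congr_fun fun n => ?_
    push_cast
    ring
  have e1 := coeff_add_coeff_eq_zero hd hD (s := -1) fun z => by
    rw [zpow_neg_one, mul_sub, Complex.sub_re, sub_eq_zero]
    exact le_antisymm (half hg.1.1 h1 z) (half hf.1.1 (fun c hc => (h1 c hc).symm) z)
  have e2 := coeff_add_coeff_eq_zero hd hD (s := 1) fun z => by
    rw [zpow_one, mul_sub, Complex.sub_re, sub_eq_zero]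
    exact le_antisymm (halfinv hg.1.1 h2 z) (halfinv hf.1.1 (fun c hc => (h2 c hc).symm) z)
  have hzero := eq_zero_of_summable_of_periodic hd (q := 4) (by norm_num) fun n => by
    have e3 := e1 (n + 3)
    have e4 := e2 (n + 1)
    rw [show n + 3 - -1 = n + 4 by ring, show -(n + 3) - -1 = -n - 2 by ring] at e3
    rw [show n + 1 - 1 = n by ring, show -(n + 1) - 1 = -n - 2 by ring] at e4
    linarith
  have hab : ∀ n, a n = b n := fun n => sub_eq_zero.1 (congrFun hzero n)
  exact funext fun z => (hfa z).unique (by simpa only [hab] using hgb z)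

theorem Circle.exists_zpow_eq_re_nonneg {j : ℤ} (hj : 2 ≤ |j|) (w : Circle) :
    ∃ ζ : Circle, ζ ^ j = w ∧ 0 ≤ ((w : ℂ)⁻¹ * ζ).re := by
  set α := Complex.arg ((w ^ (1 - j) : Circle) : ℂ) with hα
  have hj' : (2 : ℝ) ≤ |(j : ℝ)| := by exact_mod_cast hj
  have hj0 : (j : ℝ) ≠ 0 := fun h => by simp [h] at hj'; linarith
  refine ⟨w * Circle.exp (α / j), ?_, ?_⟩
  · rw [mul_zpow, ← Circle.exp_intCast_mul, mul_div_cancel₀ _ hj0, hα, Circle.exp_arg,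
      ← zpow_add]
    simp
  · rw [Circle.coe_mul, inv_mul_cancel_left₀ (Circle.coe_ne_zero w), Circle.coe_exp,
      Complex.exp_ofReal_mul_I_re]
    have hle : |α / j| ≤ Real.pi / 2 := by
      rw [abs_div, div_le_div_iff₀ (by linarith) two_pos]
      exact mul_le_mul (Complex.abs_arg_le_pi _) hj' two_pos.le Real.pi_pos.le
    exact Real.cos_nonneg_of_neg_pi_div_two_le_of_le (abs_le.1 hle).1 (abs_le.1 hle).2

theorem eq_neg_of_zpow_add_zpow_im_eq_zero {j l : ℤ}
    (h : ∀ z : Circle, ((z : ℂ) ^ j + (z : ℂ) ^ l).im = 0) : l = -j := by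
  have hsin : (fun θ : ℝ => Real.sin (j * θ) + Real.sin (l * θ)) = fun _ => 0 := by
    funext θ
    have := h (Circle.exp θ)
    rwa [← Circle.coe_zpow, ← Circle.coe_zpow, ← Circle.exp_intCast_mul, ← Circle.exp_intCast_mul,
      Circle.coe_exp, Circle.coe_exp, Complex.add_im, Complex.exp_ofReal_mul_I_im,
      Complex.exp_ofReal_mul_I_im] at this
  have hd : HasDerivAt (fun θ : ℝ => Real.sin (j * θ) + Real.sin (l * θ)) ((j : ℝ) + l) 0 := by
    have hk : ∀ k : ℝ, HasDerivAt (fun θ : ℝ => Real.sin (k * θ)) k 0 := fun k => by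
      simpa using ((hasDerivAt_id (0 : ℝ)).const_mul k).sin
    exact (hk j).add (hk l)
  rw [hsin] at hd
  have h0 := hd.unique (hasDerivAt_const (0 : ℝ) (0 : ℝ))
  have : j + l = 0 := by exact_mod_cast h0
  omega

theorem exists_exponent_of_spectrally_additive {T : (Circle → ℂ) → (Circle → ℂ)}
    (hsurj : ∀ g, InWienerPlus g → ∃ f, InWienerPlus f ∧ T f = g)
    (hspec : ∀ f g, InWienerPlus f → InWienerPlus g →
      (Set.range fun z => T f z + T g z) = (Set.range fun z => f z + g z)) (i : ℤ) :
    ∃ j : ℤ, ∀ c : ℝ, 0 < c →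
      T (fun z => (c : ℂ) * (z : ℂ) ^ j) = fun z : Circle => (c : ℂ) * (z : ℂ) ^ i := by
  have hex : ∀ c : ℝ, 0 < c → ∃ k : ℤ,
      T (fun z => (c : ℂ) * (z : ℂ) ^ k) = fun z : Circle => (c : ℂ) * (z : ℂ) ^ i := by
    intro c hc
    obtain ⟨f, hf, hTf⟩ := hsurj _ (inWienerPlus_const_mul_zpow hc.le i)
    obtain ⟨k, rfl⟩ := hf.eq_const_mul_zpow hc fun z => by
      obtain ⟨y, hy⟩ : f z + f z ∈ Set.range fun z => T f z + T f z :=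
        hspec f f hf hf ▸ Set.mem_range_self z
      have : f z = (c : ℂ) * (y : ℂ) ^ i := by
        rw [hTf] at hy
        linear_combination -hy / 2
      rw [this, norm_mul, Circle.norm_zpow_coe, mul_one, Complex.norm_of_nonneg hc.le]
    exact ⟨k, hTf⟩
  choose! k hk using hex
  refine ⟨k 1, fun c hc => ?_⟩
  suffices k c = k 1 by rw [← this, hk c hc]
  refine eq_of_add_le_norm_add_zpow hc one_pos fun z => ?_
  have hr := hspec _ _ (inWienerPlus_const_mul_zpow hc.le (k c))
    (inWienerPlus_const_mul_zpow zero_le_one (k 1))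
  rw [hk c hc, hk 1 one_pos] at hr
  have hmem := Set.mem_range_self (f := fun z : Circle =>
    (c : ℂ) * (z : ℂ) ^ k c + ((1 : ℝ) : ℂ) * (z : ℂ) ^ k 1) z
  rw [← hr] at hmem
  obtain ⟨y, hy⟩ := hmem
  dsimp only at hy
  rw [← hy, ← add_mul, norm_mul, Circle.norm_zpow_coe, mul_one, ← Complex.ofReal_add,
    Complex.norm_of_nonneg (by positivity)]

theorem spectrally_additive_maps_on_cone (T : (Circle → ℂ) → (Circle → ℂ))
    (hmap : ∀ f, InWienerPlus f → InWienerPlus (T f))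
    (hsurj : ∀ g, InWienerPlus g → ∃ f, InWienerPlus f ∧ T f = g)
    (hspec : ∀ f g, InWienerPlus f → InWienerPlus g →
      (Set.range fun z => T f z + T g z) = (Set.range fun z => f z + g z)) :
    (∀ f, InWienerPlus f → T f = f) ∨
      (∀ f, InWienerPlus f → T f = fun z => (starRingEnd ℂ) (f z)) := by
  obtain ⟨j, hj⟩ := exists_exponent_of_spectrally_additive hsurj hspec 1
  obtain ⟨l, hl⟩ := exists_exponent_of_spectrally_additive hsurj hspec (-1)
  have hmem : ∀ f g, InWienerPlus f → InWienerPlus g → ∀ z, ∃ y, f z + g z = T f y + T g y := by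
    intro f g hf hg z
    obtain ⟨y, hy⟩ : f z + g z ∈ Set.range fun z => T f z + T g z :=
      hspec f g hf hg ▸ Set.mem_range_self z
    exact ⟨y, hy.symm⟩
  have hmono : ∀ k : ℤ, InWienerPlus fun z => ((1 : ℝ) : ℂ) * (z : ℂ) ^ k := fun k =>
    inWienerPlus_const_mul_zpow zero_le_one k
  obtain rfl : l = -j := eq_neg_of_zpow_add_zpow_im_eq_zero fun z => by
    obtain ⟨y, hy⟩ := hmem _ _ (hmono j) (hmono l) z
    rw [hj 1 one_pos, hl 1 one_pos] at hy
    simp only [Complex.ofReal_one, one_mul] at hy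
    rw [hy, zpow_one, zpow_neg_one, ← Circle.coe_inv, Circle.coe_inv_eq_conj]
    simp
  have hr1 : ∀ f, InWienerPlus f → ∀ c : ℝ, 0 < c →
      (Set.range fun z : Circle => T f z + c * (z : ℂ)) =
        Set.range fun z : Circle => f z + c * (z : ℂ) ^ j := by
    intro f hf c hc
    simpa [hj c hc] using hspec f _ hf (inWienerPlus_const_mul_zpow hc.le j)
  have hr2 : ∀ f, InWienerPlus f → ∀ c : ℝ, 0 < c →
      (Set.range fun z : Circle => T f z + c * (z : ℂ)⁻¹) =
        Set.range fun z : Circle => f z + c * (z : ℂ) ^ (-j) := by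
    intro f hf c hc
    have := hspec f _ hf (inWienerPlus_const_mul_zpow hc.le (-j))
    rw [hl c hc] at this
    simpa only [zpow_neg_one] using this
  by_cases hj1 : j = 1
  · subst hj1
    refine Or.inl fun f hf => (hmap f hf).eq_of_range_add_eq hf (fun c hc => ?_) fun c hc => ?_
    · simpa using hr1 f hf c hc
    · simpa using hr2 f hf c hc
  by_cases hj2 : j = -1
  · subst hj2
    refine Or.inr fun f hf => ?_
    obtain ⟨hcf, hconj⟩ := inWienerPlus_conj hf
    refine (hmap f hf).eq_of_range_add_eq hcf (fun c hc => ?_) fun c hc => ?_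
    · rw [hr1 f hf c hc, ← (Equiv.inv Circle).surjective.range_comp]
      simp [Function.comp_def, hconj]
    · rw [hr2 f hf c hc, ← (Equiv.inv Circle).surjective.range_comp]
      simp [Function.comp_def, hconj]
  exfalso
  have hj0 : j ≠ 0 := by
    rintro rfl
    have hr := hspec _ _ (hmono 0) (hmono 0)
    rw [hj 1 one_pos] at hr
    have h1 := Set.mem_range_self (f := fun z : Circle =>
      ((1 : ℝ) : ℂ) * (z : ℂ) ^ (1 : ℤ) + ((1 : ℝ) : ℂ) * (z : ℂ) ^ (1 : ℤ)) (-1)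
    rw [hr] at h1
    obtain ⟨y, hy⟩ := h1
    norm_num at hy
  have habs : 2 ≤ |j| := by
    cases abs_cases j <;> omega
  obtain ⟨m, hm⟩ := (hmap _ (hmono 1)).eq_const_mul_zpow one_pos fun z => by
    have hr := hspec _ _ (hmono 1) (hmono 1)
    have h1 := Set.mem_range_self (f := fun y : Circle =>
      T (fun z => ((1 : ℝ) : ℂ) * (z : ℂ) ^ (1 : ℤ)) y +
        T (fun z => ((1 : ℝ) : ℂ) * (z : ℂ) ^ (1 : ℤ)) y) z
    rw [hr] at h1
    obtain ⟨y, hy⟩ := h1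
    have : T (fun z => ((1 : ℝ) : ℂ) * (z : ℂ) ^ (1 : ℤ)) z = ((1 : ℝ) : ℂ) * (y : ℂ) ^ (1 : ℤ) := by
      linear_combination -hy / 2
    rw [this]
    simp [Circle.norm_coe]
  have hm1 : m ≠ 1 := by
    rintro rfl
    refine hj1 (eq_of_add_le_norm_add_zpow one_pos one_pos fun z => ?_)
    obtain ⟨y, hy⟩ := hmem _ _ (hmono j) (hmono 1) z
    rw [hy, hm, hj 1 one_pos, ← add_mul, norm_mul, Circle.norm_zpow_coe]
    norm_num
  obtain ⟨w, hw⟩ := Circle.exists_zpow_eq_neg_zpow hm1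
  obtain ⟨ζ, rfl, hζ⟩ := Circle.exists_zpow_eq_re_nonneg habs w
  have hle := re_le_of_forall_exists_add_mul_eq (p := fun z => z ^ j)
    (f := fun z => ((1 : ℝ) : ℂ) * (z : ℂ) ^ (1 : ℤ))
    (hmap _ (hmono 1)).1.1 (fun n hn z => by
      obtain ⟨y, hy⟩ := hmem _ _ (hmono 1)
        (inWienerPlus_const_mul_zpow (Nat.cast_nonneg (α := ℝ) n) j) z
      rw [hj n (by exact_mod_cast hn)] at hy
      exact ⟨y, by simpa using hy⟩) ζ
  rw [hm] at hle
  simp only [Complex.ofReal_one, one_mul, hw, zpow_one, mul_neg,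
    inv_mul_cancel₀ (Circle.coe_ne_zero _), Complex.neg_re, Complex.one_re] at hle
  linarith
end

section
/- Let T : A(𝕋)₊ → A(𝕋)₊ be a surjective map satisfying (T f + T g)(𝕋) = (f + g)(𝕋) for all f, g ∈ A(𝕋)₊. Then T maps the constant function 1 to itself: T(1) = 1. -/
theorem fourierCoeffCircle_one (n : ℤ) :
    fourierCoeffCircle (fun _ => 1) n = if n = 0 then 1 else 0 := by
  unfold fourierCoeffCircle
  split_ifs with hn
  · subst hn
    have hpi : (Real.pi : ℂ) ≠ 0 := Complex.ofReal_ne_zero.mpr Real.pi_ne_zero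
    simp
    field_simp
  · have hc : -(n : ℂ) * Complex.I ≠ 0 :=
      mul_ne_zero (neg_ne_zero.mpr (Int.cast_ne_zero.mpr hn)) Complex.I_ne_zero
    have hexp : Complex.exp (-(n : ℂ) * Complex.I * (2 * Real.pi : ℝ)) = 1 :=
      Complex.exp_eq_one_iff.mpr ⟨-n, by push_cast; ring⟩
    simp only [one_mul]
    rw [integral_exp_mul_complex hc, hexp]
    simp

theorem inWienerPlus_one : InWienerPlus (fun _ => 1) := by
  refine ⟨⟨continuous_const, ?_⟩, fun n => ?_⟩
  · refine summable_of_ne_finset_zero (s := {0}) fun n hn => ?_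
    rw [fourierCoeffCircle_one, if_neg (by simpa using hn), norm_zero]
  · rw [fourierCoeffCircle_one]
    split_ifs
    · exact ⟨1, zero_le_one, by simp⟩
    · exact ⟨0, le_rfl, by simp⟩

theorem T_fixes_one (T : (Circle → ℂ) → (Circle → ℂ))
    (hmap : ∀ f, InWienerPlus f → InWienerPlus (T f))
    (hsurj : ∀ g, InWienerPlus g → ∃ f, InWienerPlus f ∧ T f = g)
    (hspec : ∀ f g, InWienerPlus f → InWienerPlus g →
      (Set.range fun z => T f z + T g z) = (Set.range fun z => f z + g z)) :
    T (fun _ : Circle => (1 : ℂ)) = fun _ : Circle => (1 : ℂ) := by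
  funext z
  have hz : T (fun _ => 1) z + T (fun _ => 1) z ∈ Set.range fun _ : Circle => (1 : ℂ) + 1 :=
    hspec _ _ inWienerPlus_one inWienerPlus_one ▸ Set.mem_range_self z
  obtain ⟨_, hw⟩ := hz
  dsimp only at hw
  linear_combination -hw / 2
end

section
/- Let m ∈ ℤ with m ≠ 1, and let a, b ∈ ℤ with a ≠ b. If {z + z^m : z ∈ 𝕋} = {z^a + z^b : z ∈ 𝕋} (where the monomials z^a, z^b correspond to T(z) and T(z^m) respectively, i.e., the ranges of z + z^m and z^a + z^b on 𝕋 coincide), then b = a·m or a = b·m. -/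
open Filter Topology

/-- Near the point `2`, the curve `t ↦ exp (i a t) + exp (i b t)` satisfies
`(Im w)² / (4 - |w|²) → ((a + b) / (a - b))²`. -/
theorem tendsto_im_sq_div_exp_add_exp (a b : ℤ) (hab : a ≠ b) :
    Tendsto (fun t : ℝ => ((Circle.exp t : ℂ) ^ a + (Circle.exp t : ℂ) ^ b).im ^ 2 /
      (4 - Complex.normSq ((Circle.exp t : ℂ) ^ a + (Circle.exp t : ℂ) ^ b)))
      (𝓝[≠] 0) (𝓝 (((a + b : ℝ) / (a - b)) ^ 2)) := by
  have hpow (t : ℝ) (k : ℤ) : (Circle.exp t : ℂ) ^ k =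
      (Real.cos (k * t) : ℂ) + (Real.sin (k * t) : ℂ) * Complex.I := by
    rw [Circle.coe_exp, ← Complex.exp_int_mul, Complex.ofReal_cos, Complex.ofReal_sin,
      ← Complex.exp_mul_I]
    push_cast
    ring_nf
  have him (t : ℝ) : ((Circle.exp t : ℂ) ^ a + (Circle.exp t : ℂ) ^ b).im =
      Real.sin (a * t) + Real.sin (b * t) := by
    rw [hpow, hpow]; simp [-Complex.ofReal_cos, -Complex.ofReal_sin]
  have hre (t : ℝ) : ((Circle.exp t : ℂ) ^ a + (Circle.exp t : ℂ) ^ b).re =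
      Real.cos (a * t) + Real.cos (b * t) := by
    rw [hpow, hpow]; simp [-Complex.ofReal_cos, -Complex.ofReal_sin]
  have hsq (t : ℝ) : 4 - Complex.normSq ((Circle.exp t : ℂ) ^ a + (Circle.exp t : ℂ) ^ b) =
      (2 * Real.sin ((a - b) / 2 * t)) ^ 2 := by
    rw [Complex.normSq_apply, him, hre]
    have h1 : Real.cos (a * t - b * t) = 1 - 2 * Real.sin ((a - b) / 2 * t) ^ 2 := by
      rw [show (a * t - b * t : ℝ) = 2 * ((a - b) / 2 * t) by ring, Real.cos_two_mul,
        Real.cos_sq']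
      ring
    rw [Real.cos_sub] at h1
    linarith [Real.sin_sq_add_cos_sq (a * t), Real.sin_sq_add_cos_sq (b * t)]
  have hsin (c : ℝ) : HasDerivAt (fun t : ℝ => Real.sin (c * t)) c 0 := by
    simpa using ((hasDerivAt_id (0 : ℝ)).const_mul c).sin
  have hnum := hasDerivAt_iff_tendsto_slope.1 ((hsin a).add (hsin b))
  have hden := hasDerivAt_iff_tendsto_slope.1 ((hsin ((a - b) / 2)).const_mul 2)
  have hne : (2 * ((a - b : ℝ) / 2)) ≠ 0 := by
    have : (a : ℝ) - b ≠ 0 := sub_ne_zero.2 (by exact_mod_cast hab)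
    simpa
  have key := (hnum.div hden hne).pow 2
  rw [mul_div_cancel₀ _ (two_ne_zero' ℝ)] at key
  refine key.congr' ?_
  filter_upwards [self_mem_nhdsWithin] with t ht
  have ht : t ≠ 0 := ht
  rw [him, hsq, ← div_pow]
  simp only [slope_def_field, Pi.div_apply, Pi.add_apply, mul_zero, Real.sin_zero, add_zero,
    sub_zero]
  rw [div_div_div_cancel_right₀ ht]

theorem Circle.tendsto_arg_nhdsNE_one :
    Tendsto (fun z : Circle => Complex.arg z) (𝓝[≠] 1) (𝓝[≠] 0) := by
  refine tendsto_nhdsWithin_iff.2 ⟨?_, ?_⟩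
  · have h : ContinuousAt (fun z : Circle => Complex.arg z) 1 :=
      ContinuousAt.comp (f := fun z : Circle => (z : ℂ)) (g := Complex.arg)
        (Complex.continuousAt_arg (by simp)) continuous_subtype_val.continuousAt
    simpa [ContinuousAt] using h.mono_left nhdsWithin_le_nhds
  · filter_upwards [self_mem_nhdsWithin] with z hz h0
    exact hz (by rw [← Circle.exp_arg z, show Complex.arg z = 0 from h0, Circle.exp_zero]; rfl)

theorem Circle.tendsto_exp_nhdsNE_zero : Tendsto Circle.exp (𝓝[≠] 0) (𝓝[≠] 1) := by
  refine tendsto_nhdsWithin_iff.2 ⟨?_, ?_⟩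
  · simpa using (Circle.exp.continuous.tendsto 0).mono_left nhdsWithin_le_nhds
  · filter_upwards [self_mem_nhdsWithin, nhdsWithin_le_nhds
      (Ioo_mem_nhds (neg_lt_zero.2 Real.pi_pos) Real.pi_pos)] with t ht ht' h1
    apply ht
    have := Circle.arg_exp ht'.1 ht'.2.le
    rw [show Circle.exp t = 1 from h1] at this
    simpa using this.symm

theorem Circle.eq_one_of_coe_add_coe_eq_two {z w : Circle} (h : (z : ℂ) + w = 2) : z = 1 := by
  have hz := Complex.normSq_apply (z : ℂ)
  have hw := Complex.normSq_apply (w : ℂ)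
  rw [Circle.normSq_coe] at hz hw
  have hr : (z : ℂ).re + (w : ℂ).re = 2 := by simpa using congrArg Complex.re h
  have h1 : (z : ℂ).re = 1 := by
    nlinarith [mul_self_nonneg (z : ℂ).im, mul_self_nonneg (w : ℂ).im]
  have h2 : (z : ℂ).im = 0 := by
    rw [h1] at hz
    nlinarith
  exact Circle.ext (Complex.ext (by simpa using h1) (by simpa using h2))

theorem range_monomial_sum_eq (m : ℤ) (hm : m ≠ 1) (a b : ℤ) (hab : a ≠ b)
    (h : (Set.range fun z : Circle => (z : ℂ) + (z : ℂ) ^ m) =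
        Set.range fun z : Circle => (z : ℂ) ^ a + (z : ℂ) ^ b) :
    b = a * m ∨ a = b * m := by
  have hex (t : ℝ) : ∃ w : Circle, (w : ℂ) ^ a + (w : ℂ) ^ b =
      (Circle.exp t : ℂ) + (Circle.exp t : ℂ) ^ m :=
    h.subset ⟨Circle.exp t, rfl⟩
  choose f hf using hex
  let U : Ultrafilter ℝ := Ultrafilter.of (𝓝[≠] 0)
  have hU : (U : Filter ℝ) ≤ 𝓝[≠] 0 := Ultrafilter.of_le _
  obtain ⟨ζ, -, hζ⟩ := isCompact_univ.ultrafilter_le_nhds (U.map f) (by simp)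
  have hfζ : Tendsto f U (𝓝 ζ) := hζ
  have hexp : Tendsto Circle.exp U (𝓝[≠] 1) := Circle.tendsto_exp_nhdsNE_zero.mono_left hU
  have hcoe : Continuous fun z : Circle => (z : ℂ) := continuous_subtype_val
  have hsum (c d : ℤ) : Continuous fun z : Circle => ((z ^ c : Circle) : ℂ) + (z ^ d : Circle) :=
    (hcoe.comp (continuous_zpow c)).add (hcoe.comp (continuous_zpow d))
  have hζ2 : ((ζ ^ a : Circle) : ℂ) + (ζ ^ b : Circle) = 2 := by
    have h1 := ((hsum a b).tendsto ζ).comp hfζ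
    have h2 := ((hsum 1 m).tendsto 1).comp (hexp.mono_right nhdsWithin_le_nhds)
    have h3 := tendsto_nhds_unique h1 (h2.congr fun t => by simp [hf])
    rw [h3]
    norm_num
  have hζa : ζ ^ a = 1 := Circle.eq_one_of_coe_add_coe_eq_two hζ2
  have hζb : ζ ^ b = 1 := Circle.eq_one_of_coe_add_coe_eq_two ((add_comm _ _).trans hζ2)
  have hg (t : ℝ) : ((f t / ζ : Circle) : ℂ) ^ a + ((f t / ζ : Circle) : ℂ) ^ b =
      (Circle.exp t : ℂ) ^ (1 : ℤ) + (Circle.exp t : ℂ) ^ m := by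
    rw [zpow_one, ← hf, ← Circle.coe_zpow, ← Circle.coe_zpow, div_zpow, div_zpow, hζa, hζb]
    simp
  have hg1 : Tendsto (fun t => f t / ζ) U (𝓝[≠] 1) := by
    refine tendsto_nhdsWithin_iff.2 ⟨by simpa using hfζ.div_const' ζ, ?_⟩
    filter_upwards [(tendsto_nhdsWithin_iff.1 hexp).2] with t ht h1
    refine ht (Circle.eq_one_of_coe_add_coe_eq_two (w := Circle.exp t ^ m) ?_)
    have h2 := hg t
    rw [show f t / ζ = 1 from h1, zpow_one] at h2
    rw [Circle.coe_zpow, ← h2]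
    norm_num
  have hlim := (tendsto_im_sq_div_exp_add_exp a b hab).comp
    (Circle.tendsto_arg_nhdsNE_one.comp hg1)
  have hlim' := (tendsto_im_sq_div_exp_add_exp 1 m hm.symm).mono_left hU
  have heq := tendsto_nhds_unique hlim
    (hlim'.congr fun t => by simp only [Function.comp_apply, Circle.exp_arg, hg])
  have h1 : (a : ℝ) - b ≠ 0 := sub_ne_zero.2 (by exact_mod_cast hab)
  have h2 : ((1 : ℤ) : ℝ) - m ≠ 0 := sub_ne_zero.2 (by exact_mod_cast hm.symm)
  rcases sq_eq_sq_iff_eq_or_eq_neg.1 heq with h3 | h3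
  · left
    rw [div_eq_div_iff h1 h2] at h3
    have : (b : ℝ) = a * m := by push_cast at h3; linarith
    exact_mod_cast this
  · right
    rw [← neg_div, div_eq_div_iff h1 h2] at h3
    have : (a : ℝ) = b * m := by push_cast at h3; linarith
    exact_mod_cast this
end

section
/- Let f, g ∈ A(𝕋)₊ be such that for every real λ > 0 and every n ∈ {1, −1}, the ranges of f + λ z^n and g + λ z^n on 𝕋 coincide, i.e., {f(z) + λ z^n : z ∈ 𝕋} = {g(z) + λ z^n : z ∈ 𝕋}. Then f = g. -/
open Filter Topology in
/-- If the ranges of `f + λ z` and `g + λ z` on the circle coincide for all `λ > 0`, then `g - f` is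
everywhere tangent to the circle. -/
theorem re_sub_mul_conj_eq_zero_of_ranges_eq {f g : Circle → ℂ} (hg : Continuous g)
    (h : ∀ lam : ℝ, 0 < lam →
      (Set.range fun z : Circle => f z + (lam : ℂ) * (z : ℂ)) =
        Set.range fun z : Circle => g z + (lam : ℂ) * (z : ℂ)) (z : Circle) :
    ((g z - f z) * (starRingEnd ℂ) z).re = 0 := by
  have hex : ∀ k : ℕ, ∃ w : Circle,
      g w + (((k : ℝ) + 1 : ℝ) : ℂ) * (w : ℂ) = f z + (((k : ℝ) + 1 : ℝ) : ℂ) * (z : ℂ) := by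
    intro k
    have hmem := Set.mem_range_self (f := fun z : Circle =>
      f z + (((k : ℝ) + 1 : ℝ) : ℂ) * (z : ℂ)) z
    rwa [h _ (by positivity)] at hmem
  choose w hw using hex
  have hdiff : ∀ k : ℕ,
      g (w k) - f z = (((k : ℝ) + 1 : ℝ) : ℂ) * ((z : ℂ) - (w k : ℂ)) := fun k => by
    linear_combination hw k
  obtain ⟨C, hC⟩ : ∃ C, ∀ x, ‖g x - f z‖ ≤ C := by
    obtain ⟨C, hC⟩ := isCompact_univ.exists_bound_of_continuousOn
      (f := fun x => g x - f z) (by fun_prop)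
    exact ⟨C, fun x => hC x (Set.mem_univ x)⟩
  have hdist : ∀ k : ℕ, ‖(w k : ℂ) - z‖ ≤ C * (1 / ((k : ℝ) + 1)) := by
    intro k
    have hk := hC (w k)
    have hpos : (0 : ℝ) < k + 1 := by positivity
    rw [hdiff, norm_mul, Complex.norm_real, Real.norm_of_nonneg hpos.le, norm_sub_rev] at hk
    rw [mul_one_div, le_div_iff₀ hpos]
    linarith
  have hbound : Tendsto (fun k : ℕ => C * (1 / ((k : ℝ) + 1))) atTop (𝓝 0) := by
    simpa using (tendsto_one_div_add_atTop_nhds_zero_nat (𝕜 := ℝ)).const_mul C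
  have hcoe : Tendsto (fun k => (w k : ℂ)) atTop (𝓝 (z : ℂ)) :=
    tendsto_iff_norm_sub_tendsto_zero.2
      (squeeze_zero (fun _ => norm_nonneg _) hdist hbound)
  have hlim : Tendsto w atTop (𝓝 z) := tendsto_subtype_rng.2 hcoe
  have hre : ∀ k : ℕ, ((g (w k) - f z) * (starRingEnd ℂ) z).re =
      ‖g (w k) - f z‖ * ‖(w k : ℂ) - z‖ / 2 := by
    intro k
    have hpos : (0 : ℝ) < k + 1 := by positivity
    have hz : (z : ℂ).re * (z : ℂ).re + (z : ℂ).im * (z : ℂ).im = 1 := by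
      rw [← Complex.normSq_apply, Circle.normSq_coe]
    have hwk : (w k : ℂ).re * (w k : ℂ).re + (w k : ℂ).im * (w k : ℂ).im = 1 := by
      rw [← Complex.normSq_apply, Circle.normSq_coe]
    rw [hdiff, norm_mul, Complex.norm_real, Real.norm_of_nonneg hpos.le, norm_sub_rev (z : ℂ),
      mul_assoc, mul_assoc, Complex.re_ofReal_mul, ← sq, Complex.sq_norm, Complex.normSq_apply]
    simp only [Complex.mul_re, Complex.sub_re, Complex.sub_im, Complex.conj_re, Complex.conj_im]
    linear_combination ((k : ℝ) + 1) / 2 * (hz - hwk)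
  have hzero : Tendsto (fun k => ‖g (w k) - f z‖ * ‖(w k : ℂ) - z‖ / 2) atTop (𝓝 0) := by
    have := (((hg.tendsto z).comp hlim).sub_const (f z)).norm.mul (hcoe.sub_const (z : ℂ)).norm
    simpa using this.div_const 2
  have hleft : Tendsto (fun k => ((g (w k) - f z) * (starRingEnd ℂ) z).re) atTop
      (𝓝 ((g z - f z) * (starRingEnd ℂ) z).re) :=
    (Complex.continuous_re.tendsto _).comp
      ((((hg.tendsto z).comp hlim).sub_const (f z)).mul_const _)
  simp only [hre] at hleft
  exact tendsto_nhds_unique hleft hzero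

theorem Real.dense_setOf_sin_two_mul_ne_zero : Dense {θ : ℝ | Real.sin (2 * θ) ≠ 0} := by
  have hsub : {θ : ℝ | Real.sin (2 * θ) = 0} ⊆ Set.range fun n : ℤ => (n : ℝ) * Real.pi / 2 := by
    intro θ hθ
    obtain ⟨n, hn⟩ := Real.sin_eq_zero_iff.1 hθ
    exact ⟨n, by simp only [hn]; ring⟩
  exact ((Set.countable_range _).mono hsub).dense_compl ℝ

theorem eq_of_ranges_of_perturbations_eq (f g : Circle → ℂ)
    (hf : InWienerPlus f) (hg : InWienerPlus g)
    (h : ∀ lam : ℝ, 0 < lam → ∀ n : ℤ, n = 1 ∨ n = -1 →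
      (Set.range fun z : Circle => f z + (lam : ℂ) * (z : ℂ) ^ n) =
        Set.range fun z : Circle => g z + (lam : ℂ) * (z : ℂ) ^ n) :
    f = g := by
  have hfc : Continuous f := hf.1.1
  have hgc : Continuous g := hg.1.1
  have hconj (z : Circle) : ((g z - f z) * (starRingEnd ℂ) z).re = 0 :=
    re_sub_mul_conj_eq_zero_of_ranges_eq hgc
      (fun lam hlam => by simpa using h lam hlam 1 (Or.inl rfl)) z
  have hmul (z : Circle) : ((g z - f z) * z).re = 0 := by
    have hrange (F : Circle → ℂ) (lam : ℝ) :
        (Set.range fun z : Circle => F z⁻¹ + (lam : ℂ) * (z : ℂ)) =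
          Set.range fun z : Circle => F z + (lam : ℂ) * (z : ℂ) ^ (-1 : ℤ) := by
      rw [← (Equiv.inv Circle).surjective.range_comp]
      simp [Function.comp_def]
    have hinv := re_sub_mul_conj_eq_zero_of_ranges_eq (f := fun z => f z⁻¹)
      (g := fun z => g z⁻¹) (by fun_prop)
      (fun lam hlam => by rw [hrange f, hrange g]; exact h lam hlam (-1) (Or.inr rfl)) z⁻¹
    simpa [Circle.coe_inv_eq_conj] using hinv
  have hexp : (fun θ : ℝ => f (Circle.exp θ)) = fun θ => g (Circle.exp θ) := by
    refine Continuous.ext_on Real.dense_setOf_sin_two_mul_ne_zero (by fun_prop) (by fun_prop) ?_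
    intro θ hθ
    have h₁ := hconj (Circle.exp θ)
    have h₂ := hmul (Circle.exp θ)
    simp only [Complex.mul_re, Complex.conj_re, Complex.conj_im, Circle.coe_exp,
      Complex.exp_ofReal_mul_I_re, Complex.exp_ofReal_mul_I_im] at h₁ h₂
    rw [Set.mem_ofPred_eq, Real.sin_two_mul] at hθ
    have hsin : Real.sin θ ≠ 0 := fun h0 => hθ (by simp [h0])
    have hcos : Real.cos θ ≠ 0 := fun h0 => hθ (by simp [h0])
    have hre : (g (Circle.exp θ) - f (Circle.exp θ)).re = 0 :=
      (mul_eq_zero.1 (by linarith)).resolve_right hcos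
    have him : (g (Circle.exp θ) - f (Circle.exp θ)).im = 0 :=
      (mul_eq_zero.1 (by linarith)).resolve_right hsin
    exact (sub_eq_zero.1 (Complex.ext hre him)).symm
  funext z
  rw [← Circle.exp_arg z]
  exact congrFun hexp _
end

section
/- Let T : A(𝕋) → A(𝕋) be a surjective map (defined on the whole Wiener algebra) satisfying (T f + T g)(𝕋) = (f + g)(𝕋) for all f, g ∈ A(𝕋) (i.e., σ(Tf + Tg) = σ(f + g)). Then there exists a homeomorphism φ : 𝕋 → 𝕋 such that T f = f ∘ φ for all f ∈ A(𝕋); in particular, T is an algebra isomorphism of A(𝕋). Conversely, any such composition operator satisfies (T f + T g)(𝕋) = (f + g)(𝕋) for all f, g ∈ A(𝕋). -/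
theorem summable_tsum_fiber_norm {ι : Type*} {c : ι → ℂ} (m : ι → ℤ)
    (hc : Summable fun i => ‖c i‖) :
    Summable fun k : ℤ => ∑' i, if m i = k then ‖c i‖ else 0 := by
  have h : Summable fun p : ι × ℤ => if m p.1 = p.2 then ‖c p.1‖ else 0 := by
    rw [summable_prod_of_nonneg (fun p => by dsimp only; split_ifs <;> simp)]
    refine ⟨fun i => ?_, ?_⟩
    · exact (hasSum_ite_eq' (m i) ‖c i‖).summable
    · simpa using hc
  exact h.prod_symm.prod

theorem intervalIntegral_exp_int_mul (k : ℤ) :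
    ∫ θ in (0:ℝ)..(2 * Real.pi), Complex.exp ((k : ℂ) * Complex.I * θ) =
      if k = 0 then 2 * (Real.pi : ℂ) else 0 := by
  split_ifs with hk
  · simp [hk]
  · rw [integral_exp_mul_complex (by simpa using hk)]
    have : (k : ℂ) * Complex.I * ((2 * Real.pi : ℝ) : ℂ) = k * (2 * Real.pi * Complex.I) := by
      push_cast; ring
    rw [this, Complex.exp_int_mul_two_pi_mul_I]
    simp

theorem hasSum_fourierCoeffCircle_of_hasSum {ι : Type*} [Countable ι] {c : ι → ℂ} {m : ι → ℤ}
    {f : Circle → ℂ} (hc : Summable fun i => ‖c i‖)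
    (hf : ∀ z : Circle, HasSum (fun i => c i * (z : ℂ) ^ m i) (f z)) (k : ℤ) :
    HasSum (fun i => if m i = k then c i else 0) (fourierCoeffCircle f k) := by
  have hexp (i : ι) (θ : ℝ) :
      ((Circle.exp θ : Circle) : ℂ) ^ m i * Complex.exp (-(k : ℂ) * Complex.I * θ) =
        Complex.exp (((m i - k : ℤ) : ℂ) * Complex.I * θ) := by
    rw [Circle.coe_exp, ← Complex.exp_int_mul, ← Complex.exp_add]
    congr 1; push_cast; ring
  have key := intervalIntegral.hasSum_integral_of_dominated_convergence (a := 0)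
    (b := 2 * Real.pi) (μ := MeasureTheory.volume)
    (F := fun i θ => c i * Complex.exp (((m i - k : ℤ) : ℂ) * Complex.I * θ))
    (f := fun θ => f (Circle.exp θ) * Complex.exp (-(k : ℂ) * Complex.I * θ))
    (fun i _ => ‖c i‖) (fun i => by fun_prop)
    (fun i => .of_forall fun θ _ => by
      rw [norm_mul, ← hexp, norm_mul, norm_zpow, Circle.norm_coe, Complex.norm_exp]
      simp)
    (.of_forall fun _ _ => hc) (by simp)
    (.of_forall fun θ _ => by
      simp only [← hexp, ← mul_assoc (c _)]
      exact (hf (Circle.exp θ)).mul_right _)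
  have h2 := key.mul_left (1 / (2 * (Real.pi : ℂ)))
  convert! h2 using 1
  ext i
  rw [intervalIntegral.integral_const_mul, intervalIntegral_exp_int_mul]
  have := Real.pi_ne_zero
  by_cases h : m i = k
  · rw [if_pos h, if_pos (sub_eq_zero.2 h)]
    field_simp
  · rw [if_neg h, if_neg (sub_ne_zero.2 h)]
    simp

theorem inWiener_of_hasSum {ι : Type*} [Countable ι] {c : ι → ℂ} {m : ι → ℤ}
    {f : Circle → ℂ} (hc : Summable fun i => ‖c i‖)
    (hf : ∀ z : Circle, HasSum (fun i => c i * (z : ℂ) ^ m i) (f z)) : InWiener f := by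
  constructor
  · have : f = fun z : Circle => ∑' i, c i * (z : ℂ) ^ m i := funext fun z => (hf z).tsum_eq.symm
    rw [this]
    refine continuous_tsum (fun i => ?_) hc fun i z => ?_
    · exact continuous_const.mul
        (continuous_subtype_val.zpow₀ _ fun z => Or.inl (Circle.coe_ne_zero z))
    · simp [Circle.norm_coe]
  · refine (summable_tsum_fiber_norm m hc).of_nonneg_of_le (fun _ => norm_nonneg _)
      fun k => ?_
    rw [← (hasSum_fourierCoeffCircle_of_hasSum hc hf k).tsum_eq]
    have hn : (fun i => ‖if m i = k then c i else 0‖) = fun i => if m i = k then ‖c i‖ else 0 := by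
      ext i; split_ifs <;> simp
    rw [← hn]
    refine norm_tsum_le_tsum_norm (hc.of_nonneg_of_le (fun _ => norm_nonneg _) fun i => ?_)
    split_ifs <;> simp

theorem InWiener.hasSum {f : Circle → ℂ} (hf : InWiener f) (z : Circle) :
    HasSum (fun n : ℤ => fourierCoeffCircle f n * (z : ℂ) ^ n) (f z) := by
  have : Fact (0 < 2 * Real.pi) := ⟨Real.two_pi_pos⟩
  let F : C(AddCircle (2 * Real.pi), ℂ) :=
    ⟨fun x => f x.toCircle, hf.1.comp AddCircle.continuous_toCircle⟩
  have hcoe (x : ℝ) : AddCircle.toCircle (x : AddCircle (2 * Real.pi)) = Circle.exp x := by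
    rw [AddCircle.toCircle_apply_mk, div_self Real.two_pi_pos.ne', one_mul]
  have hF (n : ℤ) : fourierCoeff F n = fourierCoeffCircle f n := by
    rw [fourierCoeff_eq_intervalIntegral F n 0, fourierCoeffCircle, zero_add,
      Complex.real_smul]
    congr 1
    · push_cast; rfl
    · refine intervalIntegral.integral_congr fun θ _ => ?_
      simp only [F, ContinuousMap.coe_mk, smul_eq_mul]
      rw [hcoe, mul_comm, fourier_coe_apply]
      congr 2
      have := Real.pi_ne_zero
      push_cast
      field_simp
  have hs : Summable (fourierCoeff F) := by
    simp_rw [funext hF]; exact hf.2.of_norm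
  obtain ⟨x, rfl⟩ : ∃ x : ℝ, Circle.exp x = z := ⟨_, Circle.exp_arg z⟩
  have h := has_pointwise_sum_fourier_series_of_summable hs (x : AddCircle (2 * Real.pi))
  simp only [hF, smul_eq_mul] at h
  simpa only [F, ContinuousMap.coe_mk, hcoe, fourier_apply, AddCircle.toCircle_zsmul,
    Circle.coe_zpow] using h

theorem InWiener.add {f g : Circle → ℂ} (hf : InWiener f) (hg : InWiener g) :
    InWiener fun z => f z + g z :=
  inWiener_of_hasSum (c := fun n => fourierCoeffCircle f n + fourierCoeffCircle g n) (m := id)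
    ((hf.2.add hg.2).of_nonneg_of_le (fun _ => norm_nonneg _) fun _ => norm_add_le _ _)
    fun z => by simpa only [add_mul, id] using (hf.hasSum z).add (hg.hasSum z)

theorem InWiener.const_mul {f : Circle → ℂ} (hf : InWiener f) (c : ℂ) :
    InWiener fun z => c * f z :=
  inWiener_of_hasSum (c := fun n => c * fourierCoeffCircle f n) (m := id)
    (by simpa only [norm_mul] using hf.2.mul_left ‖c‖)
    fun z => by simpa only [mul_assoc, id] using (hf.hasSum z).mul_left c

theorem hasSum_mul_zpow_mul {a b : ℤ → ℂ} (ha : Summable fun n => ‖a n‖)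
    (hb : Summable fun n => ‖b n‖) {z : Circle} {s t : ℂ}
    (hs : HasSum (fun n => a n * (z : ℂ) ^ n) s) (ht : HasSum (fun n => b n * (z : ℂ) ^ n) t) :
    HasSum (fun p : ℤ × ℤ => a p.1 * b p.2 * (z : ℂ) ^ (p.1 + p.2)) (s * t) := by
  have hterm : (fun p : ℤ × ℤ => a p.1 * b p.2 * (z : ℂ) ^ (p.1 + p.2)) =
      fun p => a p.1 * (z : ℂ) ^ p.1 * (b p.2 * (z : ℂ) ^ p.2) := by
    ext p
    rw [zpow_add₀ z.coe_ne_zero, mul_mul_mul_comm]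
  have hc : Summable fun p : ℤ × ℤ => a p.1 * b p.2 * (z : ℂ) ^ (p.1 + p.2) := by
    refine .of_norm ?_
    simpa only [norm_mul, norm_zpow, Circle.norm_coe, one_zpow, mul_one] using
      ha.mul_of_nonneg hb (fun _ => norm_nonneg _) fun _ => norm_nonneg _
  rw [hterm] at hc ⊢
  exact HasSum.mul (f := fun n => a n * (z : ℂ) ^ n) (g := fun n => b n * (z : ℂ) ^ n) hs ht hc

theorem InWiener.mul {f g : Circle → ℂ} (hf : InWiener f) (hg : InWiener g) :
    InWiener fun z => f z * g z :=
  inWiener_of_hasSum (c := fun p : ℤ × ℤ => fourierCoeffCircle f p.1 * fourierCoeffCircle g p.2)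
    (m := fun p => p.1 + p.2) (hf.2.mul_norm hg.2)
    fun z => hasSum_mul_zpow_mul hf.2 hg.2 (hf.hasSum z) (hg.hasSum z)

theorem InWiener.conj {f : Circle → ℂ} (hf : InWiener f) :
    InWiener fun z => starRingEnd ℂ (f z) := by
  refine inWiener_of_hasSum (c := fun n => starRingEnd ℂ (fourierCoeffCircle f n))
    (m := fun n => -n) (by simpa using hf.2) fun z => ?_
  have := (hf.hasSum z).map (starRingEnd ℂ) Complex.continuous_conj
  simpa [Function.comp_def, ← Circle.coe_inv_eq_conj] using this

theorem inWiener_coe : InWiener fun z => (z : ℂ) :=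
  inWiener_of_hasSum (ι := Unit) (c := 1) (m := 1) (hasSum_fintype _).summable
    fun z => by simp

theorem InWiener.re {f : Circle → ℂ} (hf : InWiener f) : InWiener fun z => ((f z).re : ℂ) := by
  simpa only [Complex.re_eq_add_conj, mul_add, div_eq_inv_mul] using
    (hf.const_mul 2⁻¹).add (hf.conj.const_mul 2⁻¹)

theorem InWiener.im {f : Circle → ℂ} (hf : InWiener f) : InWiener fun z => ((f z).im : ℂ) := by
  simpa using (hf.const_mul (-Complex.I)).re

theorem inWiener_zero : InWiener 0 := by
  simpa [Pi.zero_def] using inWiener_coe.const_mul 0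

/-- The Wiener algebra as a real subspace of `C(𝕋, ℂ)`. -/
def wienerSubmodule : Submodule ℝ C(Circle, ℂ) where
  carrier := {F | InWiener F}
  add_mem' hf hg := InWiener.add hf hg
  zero_mem' := inWiener_zero
  smul_mem' r F hf := by
    simpa [Complex.real_smul, Pi.smul_def] using InWiener.const_mul hf (r : ℂ)

theorem ContinuousMap.norm_eq_of_range_eq {X Y : Type*} [TopologicalSpace X] [CompactSpace X]
    [TopologicalSpace Y] [CompactSpace Y] {F : C(X, ℂ)} {G : C(Y, ℂ)}
    (h : Set.range F = Set.range G) : ‖F‖ = ‖G‖ := by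
  rw [F.norm_eq_iSup_norm, G.norm_eq_iSup_norm, ← sSup_range, ← sSup_range]
  congr 1
  rw [show Set.range (fun x => ‖F x‖) = norm '' Set.range F from Set.range_comp norm F,
    show Set.range (fun x => ‖G x‖) = norm '' Set.range G from Set.range_comp norm G, h]

theorem exists_realLinear_of_range_sub {T : (Circle → ℂ) → (Circle → ℂ)}
    (hmap : ∀ f, InWiener f → InWiener (T f))
    (hsurj : ∀ g, InWiener g → ∃ f, InWiener f ∧ T f = g)
    (hzero : T 0 = 0)
    (hsub : ∀ f g, InWiener f → InWiener g →
      (Set.range fun z => T f z - T g z) = (Set.range fun z => f z - g z)) :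
    ∃ L : wienerSubmodule →ₗ[ℝ] wienerSubmodule, ∀ F : wienerSubmodule,
      ⇑(L F : C(Circle, ℂ)) = T (F : C(Circle, ℂ)) := by
  let S : wienerSubmodule → wienerSubmodule := fun F =>
    ⟨⟨T (F : C(Circle, ℂ)), (hmap _ F.2).1⟩, hmap _ F.2⟩
  have hiso : Isometry S := Isometry.of_dist_eq fun F G => by
    rw [dist_eq_norm, dist_eq_norm]
    exact ContinuousMap.norm_eq_of_range_eq (F := (S F - S G).1) (G := (F - G).1)
      (hsub _ _ F.2 G.2)
  have hS : Function.Surjective S := fun G => by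
    obtain ⟨f, hf, hfG⟩ := hsurj _ G.2
    exact ⟨⟨⟨f, hf.1⟩, hf⟩, Subtype.ext (DFunLike.coe_injective hfG)⟩
  let e := IsometryEquiv.mk (Equiv.ofBijective S ⟨hiso.injective, hS⟩) hiso
  have he : e 0 = 0 := Subtype.ext (DFunLike.coe_injective hzero)
  exact ⟨(e.toRealLinearIsometryEquivOfMapZero he).toLinearEquiv.toLinearMap, fun F => rfl⟩

theorem Circle.eq_of_re_mul_add_im_mul_eq_one {y w : Circle}
    (h : (y : ℂ).re * (w : ℂ).re + (y : ℂ).im * (w : ℂ).im = 1) : w = y := by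
  have hy := y.normSq_coe
  have hw := w.normSq_coe
  rw [Complex.normSq_apply] at hy hw
  ext
  apply Complex.ext <;>
    nlinarith [sq_nonneg ((y : ℂ).re - (w : ℂ).re), sq_nonneg ((y : ℂ).im - (w : ℂ).im)]

/-- A real-linear functional on the Wiener algebra whose value at each `f` lies in the range of `f`
is a point evaluation. -/
theorem exists_eval_of_mem_range {L : (Circle → ℂ) → ℂ}
    (hadd : ∀ f g, InWiener f → InWiener g → L (fun z => f z + g z) = L f + L g)
    (hsmul : ∀ (r : ℝ) f, InWiener f → L (fun z => r * f z) = r * L f)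
    (hrange : ∀ f, InWiener f → L f ∈ Set.range f) :
    ∃ y : Circle, ∀ f, InWiener f → L f = f y := by
  have hI (a : Circle → ℝ) (ha : InWiener fun z => (a z : ℂ)) :
      L (fun z => Complex.I * a z) = Complex.I * L fun z => (a z : ℂ) := by
    have haI := ha.const_mul Complex.I
    obtain ⟨w₁, h₁⟩ := hrange _ ha
    obtain ⟨w₂, h₂⟩ := hrange _ haI
    obtain ⟨w, h⟩ := hrange _ (ha.add haI)
    rw [hadd _ _ ha haI, ← h₁, ← h₂] at h
    rw [← h₁, ← h₂]
    have hr := congrArg Complex.re h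
    have hi := congrArg Complex.im h
    simp at hr hi
    simp only [← hr, ← hi]
  obtain ⟨y, hy⟩ := hrange _ inWiener_coe
  have hre := inWiener_coe.re
  have him := inWiener_coe.im
  have hsplit (f : Circle → ℂ) (hf : InWiener f) :
      L f = L (fun z => ((f z).re : ℂ)) + Complex.I * L fun z => ((f z).im : ℂ) := by
    rw [← hI _ hf.im, ← hadd _ _ hf.re (hf.im.const_mul _)]
    congr 1
    ext z
    rw [mul_comm, Complex.re_add_im]
  have hcoord : L (fun z : Circle => ((z : ℂ).re : ℂ)) = (y : ℂ).re ∧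
      L (fun z : Circle => ((z : ℂ).im : ℂ)) = (y : ℂ).im := by
    have h := hsplit _ inWiener_coe
    obtain ⟨w₁, h₁⟩ := hrange _ hre
    obtain ⟨w₂, h₂⟩ := hrange _ him
    rw [← hy, ← h₁, ← h₂] at h
    rw [← h₁, ← h₂]
    have hr := congrArg Complex.re h
    have hi := congrArg Complex.im h
    simp at hr hi
    simp [hr, hi]
  let u : Circle → ℝ := fun z => (y : ℂ).re * (z : ℂ).re + (y : ℂ).im * (z : ℂ).im
  have hu : InWiener fun z => (u z : ℂ) := by
    simpa [u] using (hre.const_mul (y : ℂ).re).add (him.const_mul (y : ℂ).im)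
  have hLu : L (fun z => (u z : ℂ)) = 1 := by
    have h := hadd _ _ (hre.const_mul (y : ℂ).re) (him.const_mul (y : ℂ).im)
    rw [hsmul _ _ hre, hsmul _ _ him, hcoord.1, hcoord.2] at h
    have hy' := y.normSq_coe
    rw [Complex.normSq_apply] at hy'
    simp only [u, Complex.ofReal_add, Complex.ofReal_mul]
    rw [h]
    exact_mod_cast hy'
  have hreal (a : Circle → ℝ) (ha : InWiener fun z => (a z : ℂ)) :
      L (fun z => (a z : ℂ)) = a y := by
    obtain ⟨w₁, h₁⟩ := hrange _ ha
    obtain ⟨w, h⟩ := hrange _ (ha.add (hu.const_mul Complex.I))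
    rw [hadd _ _ ha (hu.const_mul Complex.I), hI _ hu, hLu, ← h₁] at h
    have hr := congrArg Complex.re h
    have hi := congrArg Complex.im h
    simp at hr hi
    simp only [← h₁, ← hr]
    rw [Circle.eq_of_re_mul_add_im_mul_eq_one hi]
  refine ⟨y, fun f hf => ?_⟩
  rw [hsplit f hf, hreal _ hf.re, hreal _ hf.im, mul_comm, Complex.re_add_im]

theorem spectrally_additive_on_algebra (T : (Circle → ℂ) → (Circle → ℂ))
    (hmap : ∀ f, InWiener f → InWiener (T f))
    (hsurj : ∀ g, InWiener g → ∃ f, InWiener f ∧ T f = g)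
    (hspec : ∀ f g, InWiener f → InWiener g →
      (Set.range fun z => T f z + T g z) = (Set.range fun z => f z + g z)) :
    ((∃ φ : Circle ≃ₜ Circle, ∀ f, InWiener f → T f = fun z => f (φ z)) ∧
      (∀ f g, InWiener f → InWiener g →
        (T (fun z => f z + g z) = fun z => T f z + T g z) ∧
        (T (fun z => f z * g z) = fun z => T f z * T g z) ∧
        (∀ c : ℂ, T (fun z => c * f z) = fun z => c * T f z) ∧
        (T f = T g → f = g))) ∧
    (∀ φ : Circle ≃ₜ Circle, ∀ f g : Circle → ℂ, InWiener f → InWiener g →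
      (Set.range fun z => f (φ z) + g (φ z)) = (Set.range fun z => f z + g z)) := by
  have hT0 : T 0 = 0 := by
    ext x
    have : T 0 x + T 0 x ∈ Set.range fun z => (0 : Circle → ℂ) z + (0 : Circle → ℂ) z :=
      hspec 0 0 inWiener_zero inWiener_zero ▸ ⟨x, rfl⟩
    simpa [eq_comm (a := (0 : ℂ))] using this
  have hneg (f) (hf : InWiener f) : ∀ x, T (fun z => -1 * f z) x = -T f x := fun x => by
    have : T f x + T (fun z => -1 * f z) x ∈ Set.range fun z => f z + -1 * f z :=
      hspec f _ hf (hf.const_mul _) ▸ ⟨x, rfl⟩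
    simp only [neg_mul, one_mul, add_neg_cancel, Set.range_const, Set.mem_singleton_iff] at this ⊢
    linear_combination this
  have hsub (f g) (hf : InWiener f) (hg : InWiener g) :
      (Set.range fun z => T f z - T g z) = Set.range fun z => f z - g z := by
    have := hspec f _ hf (hg.const_mul (-1))
    simp only [hneg g hg] at this
    simpa [← sub_eq_add_neg] using this
  have hrange (f) (hf : InWiener f) : Set.range (T f) = Set.range f := by
    simpa [hT0] using hspec f 0 hf inWiener_zero
  obtain ⟨L, hL⟩ := exists_realLinear_of_range_sub hmap hsurj hT0 hsub
  have heval (x : Circle) : ∃ y : Circle, ∀ f, InWiener f → T f x = f y := by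
    refine exists_eval_of_mem_range (L := fun f => T f x) (fun f g hf hg => ?_)
      (fun r f hf => ?_) fun f hf => hrange f hf ▸ ⟨x, rfl⟩
    · let F : wienerSubmodule := ⟨⟨f, hf.1⟩, hf⟩
      let G : wienerSubmodule := ⟨⟨g, hg.1⟩, hg⟩
      have h := congrArg (fun H : wienerSubmodule => H.1 x) (L.map_add F G)
      have h' : (L (F + G)).1 x = (L F).1 x + (L G).1 x := h
      rw [hL, hL, hL] at h'
      exact h'
    · let F : wienerSubmodule := ⟨⟨f, hf.1⟩, hf⟩
      have h : (L (r • F)).1 x = r • (L F).1 x :=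
        congrArg (fun H : wienerSubmodule => H.1 x) (L.map_smul r F)
      rw [hL, hL] at h
      simpa [F, Complex.real_smul] using! h
  choose φ hφ using heval
  have hcoe (x) : (φ x : ℂ) = T (fun z => (z : ℂ)) x := (hφ x _ inWiener_coe).symm
  have hcont : Continuous φ := by
    refine continuous_induced_rng.2 ?_
    exact (hmap _ inWiener_coe).1.congr fun x => (hcoe x).symm
  have hinj : Function.Injective φ := fun x x' h => by
    obtain ⟨f, hf, hfz⟩ := hsurj _ inWiener_coe
    have hx (x : Circle) : f (φ x) = x := by rw [← hφ x f hf, hfz]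
    exact Circle.ext (by rw [← hx x, ← hx x', h])
  have hsurjφ : Function.Surjective φ := fun w => by
    have : (w : ℂ) ∈ Set.range (T fun z => (z : ℂ)) := hrange _ inWiener_coe ▸ ⟨w, rfl⟩
    obtain ⟨x, hx⟩ := this
    exact ⟨x, Circle.ext ((hcoe x).trans hx)⟩
  refine ⟨⟨⟨Continuous.homeoOfEquivCompactToT2 (f := Equiv.ofBijective φ ⟨hinj, hsurjφ⟩) hcont,
    fun f hf => funext fun x => hφ x f hf⟩, fun f g hf hg => ⟨?_, ?_, fun c => ?_, fun h => ?_⟩⟩,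
    fun φ f g _ _ => φ.surjective.range_comp fun z => f z + g z⟩
  · ext x; rw [hφ x _ (hf.add hg), hφ x _ hf, hφ x _ hg]
  · ext x; rw [hφ x _ (hf.mul hg), hφ x _ hf, hφ x _ hg]
  · ext x; rw [hφ x _ (hf.const_mul c), hφ x _ hf]
  · ext w
    obtain ⟨x, rfl⟩ := hsurjφ w
    rw [← hφ x _ hf, ← hφ x _ hg, h]
end
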